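/- Let d ≥ 1, N ≥ 1, and let ρ₀,…,ρ_N be Borel probability measures on ℝ^d with finite second moments. Call a probability measure P on Ω = C([0,N];ℝ^d) admissible if it gives full measure to the set of twice continuously differentiable paths and (X_i)_#P = ρ_i for every i = 0,…,N. Then the infimum of the energy ∫_Ω ∫₀^N ‖ω''(t)‖² dt dP(ω) over all admissible measures P is attained by some admissible P̂. -/

import Mathlib

open MeasureTheory

noncomputable section

/-- The path space `Ω = C([0,N]; ℝ^d)` with the uniform metric. -/
abbrev PathSpace (d N : ℕ) := C(Set.Icc (0:ℝ) (N:ℝ), EuclideanSpace ℝ (Fin d))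

instance (d N : ℕ) : MeasurableSpace (PathSpace d N) := borel _
instance (d N : ℕ) : BorelSpace (PathSpace d N) := ⟨rfl⟩

/-- The extension of a path `ω : [0,N] → ℝ^d` to all of `ℝ` by clamping the time
variable to `[0,N]`. -/
def pathExt (d N : ℕ) (ω : PathSpace d N) : ℝ → EuclideanSpace ℝ (Fin d) :=
  fun t => ω (Set.projIcc (0:ℝ) (N:ℝ) (Nat.cast_nonneg N) t)

/-- The mean-squared acceleration `∫₀^N ‖ω''(t)‖² dt` of a path. -/
def energy (d N : ℕ) (ω : PathSpace d N) : ℝ :=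
  ∫ t in (0:ℝ)..(N:ℝ), ‖deriv (deriv (pathExt d N ω)) t‖ ^ 2

/-- The set of twice continuously differentiable paths: restrictions to `[0,N]`
of C² functions on `ℝ`. -/
def C2paths (d N : ℕ) : Set (PathSpace d N) :=
  { ω | ∃ f : ℝ → EuclideanSpace ℝ (Fin d), ContDiff ℝ 2 f ∧
      ∀ t : Set.Icc (0:ℝ) (N:ℝ), ω t = f t }

open Set Filter Topology
open scoped ENNReal NNReal

section DoublePrimitive

variable {E : Type*} [NormedAddCommGroup E] [NormedSpace ℝ E]

/-- The function with second derivative `g`, value `a` at `0` and slope `b` at `0`. -/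
def doublePrimitive (a b : E) (g : ℝ → E) (t : ℝ) : E :=
  a + t • b + (t • (∫ s in (0:ℝ)..t, g s) - ∫ s in (0:ℝ)..t, s • g s)

variable {a b : E} {g : ℝ → E}

lemma doublePrimitive_zero : doublePrimitive a b g 0 = a := by
  simp [doublePrimitive]

lemma hasDerivAt_doublePrimitive [CompleteSpace E] (hg : Continuous g) (t : ℝ) :
    HasDerivAt (doublePrimitive a b g) (b + ∫ s in (0:ℝ)..t, g s) t := by
  have h1 : HasDerivAt (fun t => ∫ s in (0:ℝ)..t, g s) (g t) t :=
    hg.integral_hasStrictDerivAt 0 t |>.hasDerivAt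
  have h2 : HasDerivAt (fun t => ∫ s in (0:ℝ)..t, s • g s) (t • g t) t :=
    (continuous_id.smul hg).integral_hasStrictDerivAt 0 t |>.hasDerivAt
  have h3 : HasDerivAt (fun t : ℝ => a + t • b) b t := by
    simpa using ((hasDerivAt_id t).smul_const b).const_add a
  convert! h3.add (((hasDerivAt_id t).smul h1).sub h2) using 1
  simp

lemma hasDerivAt_add_integral [CompleteSpace E] (hg : Continuous g) (t : ℝ) :
    HasDerivAt (fun t => b + ∫ s in (0:ℝ)..t, g s) (g t) t :=
  (hg.integral_hasStrictDerivAt 0 t).hasDerivAt.const_add b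

lemma contDiff_doublePrimitive [CompleteSpace E] (hg : Continuous g) :
    ContDiff ℝ 2 (doublePrimitive a b g) := by
  have hd : deriv (doublePrimitive a b g) = fun t => b + ∫ s in (0:ℝ)..t, g s :=
    funext fun t => (hasDerivAt_doublePrimitive hg t).deriv
  have hd2 : deriv (fun t => b + ∫ s in (0:ℝ)..t, g s) = g :=
    funext fun t => (hasDerivAt_add_integral hg t).deriv
  rw [show (2 : WithTop ℕ∞) = 1 + 1 by norm_num, contDiff_succ_iff_deriv]
  refine ⟨fun t => (hasDerivAt_doublePrimitive hg t).differentiableAt, by simp, ?_⟩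
  rw [hd, contDiff_one_iff_deriv, hd2]
  exact ⟨fun t => (hasDerivAt_add_integral hg t).differentiableAt, hg⟩

lemma ContDiff.eq_doublePrimitive [CompleteSpace E] {f : ℝ → E} (hf : ContDiff ℝ 2 f) :
    f = doublePrimitive (f 0) (deriv f 0) (deriv (deriv f)) := by
  have h1 : ContDiff ℝ 1 (deriv f) := by
    rw [show (2 : WithTop ℕ∞) = 1 + 1 by norm_num, contDiff_succ_iff_deriv] at hf
    exact hf.2.2
  have hc : Continuous (deriv (deriv f)) := h1.continuous_deriv le_rfl
  have hint : ∀ t, deriv f 0 + ∫ s in (0:ℝ)..t, deriv (deriv f) s = deriv f t := by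
    intro t
    rw [intervalIntegral.integral_deriv_eq_sub
      (fun x _ => h1.differentiable one_ne_zero x) (hc.intervalIntegrable _ _)]
    abel
  refine eq_of_fderiv_eq (𝕜 := ℝ) (x := 0) (hf.differentiable two_ne_zero)
    (contDiff_doublePrimitive hc |>.differentiable two_ne_zero) (fun t => ?_)
    doublePrimitive_zero.symm
  have h := hasDerivAt_doublePrimitive (a := f 0) (b := deriv f 0) hc t
  rw [hint] at h
  have h' := (hf.differentiable two_ne_zero t).hasDerivAt
  rw [h.hasFDerivAt.fderiv, h'.hasFDerivAt.fderiv]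

lemma doublePrimitive_congr {g' : ℝ → E} {T t : ℝ} (ht : t ∈ Icc 0 T)
    (h : EqOn g g' (Icc 0 T)) : doublePrimitive a b g t = doublePrimitive a b g' t := by
  have hsub : ∀ s ∈ uIcc 0 t, g s = g' s := fun s hs => by
    rw [uIcc_of_le ht.1] at hs
    exact h ⟨hs.1, hs.2.trans ht.2⟩
  rw [doublePrimitive, doublePrimitive, intervalIntegral.integral_congr hsub,
    intervalIntegral.integral_congr (fun s hs => by simp only [hsub s hs] :
      EqOn (fun s => s • g s) (fun s => s • g' s) (uIcc 0 t))]

/-- Taylor's formula with the remainder written over the whole interval `[0, T]`. -/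
lemma doublePrimitive_eq_integral_max (hg : Continuous g) {T t : ℝ} (ht : t ∈ Icc 0 T) :
    doublePrimitive a b g t = a + t • b + ∫ s in (0:ℝ)..T, max (t - s) 0 • g s := by
  have hc : Continuous fun s => max (t - s) 0 • g s := by fun_prop
  rw [doublePrimitive, ← intervalIntegral.integral_smul, ← intervalIntegral.integral_sub
    (Continuous.intervalIntegrable (by fun_prop) _ _)
    (Continuous.intervalIntegrable (by fun_prop) _ _),
    ← intervalIntegral.integral_add_adjacent_intervals (b := t) (hc.intervalIntegrable _ _)
      (hc.intervalIntegrable _ _)]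
  have h1 : ∫ s in t..T, max (t - s) 0 • g s = 0 := by
    rw [intervalIntegral.integral_congr (g := fun _ => (0 : E)), intervalIntegral.integral_zero]
    intro s hs
    rw [uIcc_of_le ht.2] at hs
    simp [max_eq_right (sub_nonpos.2 hs.1)]
  rw [h1, add_zero]
  congr 1
  refine intervalIntegral.integral_congr fun s hs => ?_
  rw [uIcc_of_le ht.1] at hs
  simp only [max_eq_left (sub_nonneg.2 hs.2), sub_smul]

lemma continuous_uncurry_doublePrimitive {X : Type*} [TopologicalSpace X]
    [FirstCountableTopology X] {A B : X → E} {G : X → ℝ → E} (hA : Continuous A)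
    (hB : Continuous B) (hG : Continuous (Function.uncurry G)) :
    Continuous fun p : X × ℝ => doublePrimitive (A p.1) (B p.1) (G p.1) p.2 := by
  have h1 : Continuous fun p : X × ℝ => ∫ s in (0:ℝ)..p.2, G p.1 s :=
    intervalIntegral.continuous_parametric_intervalIntegral_of_continuous
      (f := fun (p : X × ℝ) s => G p.1 s)
      (hG.comp ((continuous_fst.comp continuous_fst).prodMk continuous_snd)) continuous_snd
  have h2 : Continuous fun p : X × ℝ => ∫ s in (0:ℝ)..p.2, s • G p.1 s :=
    intervalIntegral.continuous_parametric_intervalIntegral_of_continuous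
      (f := fun (p : X × ℝ) s => s • G p.1 s)
      (continuous_snd.smul
        (hG.comp ((continuous_fst.comp continuous_fst).prodMk continuous_snd))) continuous_snd
  unfold doublePrimitive
  fun_prop

end DoublePrimitive

section HatFunctions

/-- The piecewise linear function supported on `[k, k + 2]` with peak value `1` at `k + 1`. -/
def hat (k : ℕ) (s : ℝ) : ℝ :=
  max ((k : ℝ) + 2 - s) 0 - 2 * max ((k : ℝ) + 1 - s) 0 + max ((k : ℝ) - s) 0

@[fun_prop]
lemma continuous_hat (k : ℕ) : Continuous (hat k) := by
  unfold hat
  fun_prop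

lemma hat_add_one (k j : ℕ) : hat k ((j : ℝ) + 1) = if k = j then 1 else 0 := by
  unfold hat
  rcases lt_trichotomy k j with h | rfl | h
  · have : (k : ℝ) + 1 ≤ j := by exact_mod_cast h
    rw [if_neg h.ne, max_eq_right (by linarith), max_eq_right (by linarith),
      max_eq_right (by linarith)]
    ring
  · rw [if_pos rfl, max_eq_left (by linarith), max_eq_right (by linarith),
      max_eq_right (by linarith)]
    ring
  · have : (j : ℝ) + 1 ≤ k := by exact_mod_cast h
    rw [if_neg h.ne', max_eq_left (by linarith), max_eq_left (by linarith),
      max_eq_left (by linarith)]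
    ring

variable {E : Type*} [NormedAddCommGroup E]

/-- The second difference of a function at consecutive integers is the integral of its second
derivative against a hat function. -/
lemma integral_hat_smul [NormedSpace ℝ E] {a b : E} {g : ℝ → E} (hg : Continuous g) {k N : ℕ}
    (hk : k + 2 ≤ N) :
    ∫ s in (0:ℝ)..N, hat k s • g s = doublePrimitive a b g ((k : ℝ) + 2)
      - (2:ℝ) • doublePrimitive a b g ((k : ℝ) + 1) + doublePrimitive a b g k := by
  have hkN : (k : ℝ) + 2 ≤ N := by exact_mod_cast hk
  have hk0 : (0:ℝ) ≤ k := k.cast_nonneg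
  have hI : ∀ c : ℝ, IntervalIntegrable (fun s => max (c - s) 0 • g s) volume 0 (N : ℝ) := fun c =>
    Continuous.intervalIntegrable (by fun_prop) _ _
  rw [doublePrimitive_eq_integral_max hg (T := N) (t := (k : ℝ) + 2) ⟨by linarith, by linarith⟩,
    doublePrimitive_eq_integral_max hg (T := N) (t := (k : ℝ) + 1) ⟨by linarith, by linarith⟩,
    doublePrimitive_eq_integral_max hg (T := N) (t := (k : ℝ)) ⟨by linarith, by linarith⟩]
  have : ∀ s, hat k s • g s = max ((k : ℝ) + 2 - s) 0 • g s
      - (2:ℝ) • (max ((k : ℝ) + 1 - s) 0 • g s) + max ((k : ℝ) - s) 0 • g s := fun s => by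
    rw [hat]; module
  simp_rw [this]
  have hI2 : IntervalIntegrable (fun s => (2:ℝ) • (max ((k : ℝ) + 1 - s) 0 • g s))
      volume 0 (N : ℝ) := (hI _).smul _
  rw [intervalIntegral.integral_add ((hI _).sub hI2) (hI _),
    intervalIntegral.integral_sub (hI _) hI2, intervalIntegral.integral_smul]
  module

variable [InnerProductSpace ℝ E] {n : ℕ}

/-- The piecewise linear curve with value `y j` at `j + 1`. -/
def hatCurve (y : Fin n → E) (t : ℝ) : E := ∑ j : Fin n, hat j t • y j

lemma continuous_uncurry_hatCurve :
    Continuous (Function.uncurry (hatCurve : (Fin n → E) → ℝ → E)) := by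
  simp only [Function.uncurry_def, hatCurve]
  fun_prop

lemma continuous_hatCurve (y : Fin n → E) : Continuous (hatCurve y) :=
  continuous_uncurry_hatCurve.comp (Continuous.prodMk_right y)

lemma hatCurve_add_one (y : Fin n → E) (j : Fin n) : hatCurve y ((j : ℕ) + 1 : ℝ) = y j := by
  simp [hatCurve, hat_add_one, Fin.val_inj]

lemma integral_inner_hatCurve [CompleteSpace E] {h : ℝ → E} (hh : Continuous h) (y : Fin n → E)
    (T : ℝ) :
    ∫ t in (0:ℝ)..T, inner ℝ (hatCurve y t) (h t) =
      ∑ i, inner ℝ (y i) (∫ t in (0:ℝ)..T, hat i t • h t) := by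
  have hI : ∀ i : Fin n, Continuous fun t => hat i t • h t := fun i => by fun_prop
  simp_rw [hatCurve, sum_inner, real_inner_smul_left, ← real_inner_smul_right]
  rw [intervalIntegral.integral_finsetSum fun i _ =>
    (continuous_const.inner (hI i)).intervalIntegrable _ _]
  refine Finset.sum_congr rfl fun i _ => ?_
  exact (innerSL ℝ (y i)).intervalIntegral_comp_comm ((hI i).intervalIntegrable _ _)

/-- The Gram operator of the hat functions, acting on vector-valued coefficients. -/
def hatGram (E : Type*) [NormedAddCommGroup E] [InnerProductSpace ℝ E] (n : ℕ) (T : ℝ) :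
    (Fin n → E) →ₗ[ℝ] (Fin n → E) where
  toFun y i := ∫ t in (0:ℝ)..T, hat i t • hatCurve y t
  map_add' y z := by
    funext i
    have hI : ∀ y : Fin n → E, Continuous fun t => hat i t • hatCurve y t := fun y =>
      (continuous_hat i).smul (continuous_hatCurve y)
    rw [Pi.add_apply, ← intervalIntegral.integral_add ((hI y).intervalIntegrable _ _)
      ((hI z).intervalIntegrable _ _)]
    simp [hatCurve, Finset.sum_add_distrib]
  map_smul' c y := by
    funext i
    rw [Pi.smul_apply, RingHom.id_apply, ← intervalIntegral.integral_smul]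
    refine intervalIntegral.integral_congr fun t _ => ?_
    simp only [hatCurve, Finset.smul_sum, Pi.smul_apply]
    exact Finset.sum_congr rfl fun j _ => by module

lemma hatGram_injective [CompleteSpace E] {T : ℝ} (hn : (n : ℝ) ≤ T) :
    Function.Injective (hatGram E n T) := by
  rw [injective_iff_map_eq_zero]
  intro y hy
  have hT : 0 ≤ T := n.cast_nonneg.trans hn
  have h0 : ∫ t in (0:ℝ)..T, ‖hatCurve y t‖ ^ 2 = 0 := by
    simp_rw [← real_inner_self_eq_norm_sq]
    rw [integral_inner_hatCurve (continuous_hatCurve y)]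
    refine Finset.sum_eq_zero fun i _ => ?_
    rw [show (∫ t in (0:ℝ)..T, hat i t • hatCurve y t) = 0 from congrFun hy i, inner_zero_right]
  funext j
  by_contra hj
  have hjn : ((j : ℕ) : ℝ) + 1 ≤ n := by exact_mod_cast j.2
  have hpos : 0 < ∫ t in (0:ℝ)..T, ‖hatCurve y t‖ ^ 2 := by
    refine intervalIntegral.integral_pos (by linarith [((j : ℕ).cast_nonneg : (0:ℝ) ≤ _)])
      ((continuous_hatCurve y).norm.pow 2).continuousOn (fun _ _ => by positivity)
      ⟨(j : ℕ) + 1, ⟨by positivity, hjn.trans hn⟩, ?_⟩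
    rw [hatCurve_add_one]
    have : y j ≠ 0 := hj
    positivity
  exact hpos.ne' h0

/-- Among all curves with prescribed integrals against hat functions, piecewise linear ones have
the smallest `L²` norm. -/
lemma integral_norm_sq_hatCurve_le [CompleteSpace E] {T : ℝ} (hT : 0 ≤ T) {h : ℝ → E}
    (hh : Continuous h) {y : Fin n → E}
    (H : ∀ i : Fin n,
      ∫ t in (0:ℝ)..T, hat i t • h t = ∫ t in (0:ℝ)..T, hat i t • hatCurve y t) :
    ∫ t in (0:ℝ)..T, ‖hatCurve y t‖ ^ 2 ≤ ∫ t in (0:ℝ)..T, ‖h t‖ ^ 2 := by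
  have hg := continuous_hatCurve y
  have horth : ∫ t in (0:ℝ)..T, inner ℝ (hatCurve y t) (h t) =
      ∫ t in (0:ℝ)..T, inner ℝ (hatCurve y t) (hatCurve y t) := by
    rw [integral_inner_hatCurve hh, integral_inner_hatCurve hg]
    exact Finset.sum_congr rfl fun i _ => by rw [H]
  have hsq : ∫ t in (0:ℝ)..T, ‖hatCurve y t‖ ^ 2 = ∫ t in (0:ℝ)..T,
      (2 * inner ℝ (hatCurve y t) (h t) - inner ℝ (hatCurve y t) (hatCurve y t)) := by
    rw [intervalIntegral.integral_sub (Continuous.intervalIntegrable (by fun_prop) _ _)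
      (Continuous.intervalIntegrable (by fun_prop) _ _),
      intervalIntegral.integral_const_mul, horth]
    simp_rw [real_inner_self_eq_norm_sq]
    ring
  rw [hsq]
  refine intervalIntegral.integral_mono_on hT (Continuous.intervalIntegrable (by fun_prop) _ _)
    (Continuous.intervalIntegrable (by fun_prop) _ _) fun t _ => ?_
  have := norm_sub_sq_real (hatCurve y t) (h t)
  rw [real_inner_self_eq_norm_sq]
  nlinarith [sq_nonneg ‖hatCurve y t - h t‖]

end HatFunctions

/-- The integral of a nonnegative continuous function is weakly lower semicontinuous. -/
lemma lowerSemicontinuous_lintegral_ofReal {X : Type*} [MeasurableSpace X] [TopologicalSpace X]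
    [OpensMeasurableSpace X] {c : X → ℝ} (hc : Continuous c) :
    LowerSemicontinuous
      (fun π : ProbabilityMeasure X => ∫⁻ x, ENNReal.ofReal (c x) ∂(π : Measure X)) := by
  have hmin : ∀ (n : ℕ) (x : X), ENNReal.ofReal (min (c x) n) =
      min (ENNReal.ofReal (c x)) n := by
    intro n x
    rw [ENNReal.ofReal_min, ENNReal.ofReal_natCast]
  have key : (fun π : ProbabilityMeasure X => ∫⁻ x, ENNReal.ofReal (c x) ∂(π : Measure X)) =
      fun π : ProbabilityMeasure X => ⨆ n : ℕ, ∫⁻ x, ENNReal.ofReal (min (c x) n) ∂(π : Measure X) := by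
    funext π
    rw [← lintegral_iSup]
    · refine lintegral_congr fun x => ?_
      simp_rw [hmin]
      rw [← inf_iSup_eq (a := ENNReal.ofReal (c x)), ENNReal.iSup_natCast, inf_top_eq]
    · intro n
      exact ENNReal.measurable_ofReal.comp (hc.min continuous_const).measurable
    · intro n m hnm x
      have : (n : ℝ) ≤ m := by exact_mod_cast hnm
      dsimp only
      gcongr
  rw [key]
  refine lowerSemicontinuous_iSup fun n => Continuous.lowerSemicontinuous ?_
  let f : BoundedContinuousFunction X ℝ≥0 :=
    BoundedContinuousFunction.mkOfBound
      ⟨fun x => Real.toNNReal (min (c x) n), continuous_real_toNNReal.comp (hc.min continuous_const)⟩ n (by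
        intro x y
        rw [NNReal.dist_eq, abs_sub_le_iff]
        have h : ∀ z, ((Real.toNNReal (min (c z) n) : ℝ≥0) : ℝ) ≤ n := fun z => by
          rw [Real.coe_toNNReal']
          exact max_le (min_le_right _ _) n.cast_nonneg
        have hx := h x
        have hy := h y
        have := (Real.toNNReal (min (c x) n)).coe_nonneg
        have := (Real.toNNReal (min (c y) n)).coe_nonneg
        constructor <;> simp only [ContinuousMap.coe_mk] <;> linarith)
  exact ProbabilityMeasure.continuous_lintegral_boundedContinuousFunction f

/-- The probability measures on a finite product of Polish spaces with prescribed marginals form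
a weakly compact set. -/
lemma isCompact_setOf_map_eval_eq {ι X : Type*} [Fintype ι] [MeasurableSpace X]
    [TopologicalSpace X] [PolishSpace X] [BorelSpace X] (ρ : ι → ProbabilityMeasure X) :
    IsCompact {π : ProbabilityMeasure (ι → X) |
      ∀ i, π.map (measurable_pi_apply i).aemeasurable = ρ i} := by
  have hclosed : IsClosed {π : ProbabilityMeasure (ι → X) |
      ∀ i, π.map (measurable_pi_apply i).aemeasurable = ρ i} := by
    rw [ofPred_forall]
    refine isClosed_iInter fun i => isClosed_eq ?_ continuous_const
    exact ProbabilityMeasure.continuous_map (continuous_apply i)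
  rw [← hclosed.closure_eq]
  refine isCompact_closure_of_isTightMeasureSet ?_
  rw [isTightMeasureSet_iff_exists_isCompact_measure_compl_le]
  intro ε hε
  obtain ⟨δ, hδ, hδε⟩ := ENNReal.exists_pos_sum_of_countable' hε.ne' ι
  have hK : ∀ i, ∃ K : Set X, IsCompact K ∧ (ρ i : Measure X) Kᶜ ≤ δ i := by
    intro i
    obtain ⟨K, hK, h⟩ := isTightMeasureSet_iff_exists_isCompact_measure_compl_le.1
      (isTightMeasureSet_singleton (μ := (ρ i : Measure X))) (δ i) (hδ i)
    exact ⟨K, hK, h _ rfl⟩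
  choose K hK hKδ using hK
  refine ⟨univ.pi K, isCompact_univ_pi hK, ?_⟩
  rintro _ ⟨π, hπ, rfl⟩
  have hsub : (univ.pi K)ᶜ ⊆ ⋃ i, (fun x : ι → X => x i) ⁻¹' (K i)ᶜ := by
    intro x hx
    simpa [Set.mem_pi] using hx
  calc (π : Measure (ι → X)) (univ.pi K)ᶜ
      ≤ ∑' i, (π : Measure (ι → X)) ((fun x : ι → X => x i) ⁻¹' (K i)ᶜ) :=
        (measure_mono hsub).trans (measure_iUnion_le _)
    _ ≤ ∑' i, δ i := by
        refine ENNReal.tsum_le_tsum fun i => ?_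
        rw [← Measure.map_apply (measurable_pi_apply i) (hK i).measurableSet.compl]
        have := congrArg (fun μ : ProbabilityMeasure X => (μ : Measure X)) (hπ i)
        simp only [ProbabilityMeasure.toMeasure_map] at this
        rw [this]
        exact hKδ i
    _ ≤ ε := hδε.le

/-- Existence of optimal multi-marginal transport plans for nonnegative continuous costs. -/
lemma exists_optimal_coupling {ι X : Type*} [Fintype ι] [MeasurableSpace X]
    [TopologicalSpace X] [PolishSpace X] [BorelSpace X] (ρ : ι → Measure X)
    [∀ i, IsProbabilityMeasure (ρ i)] {c : (ι → X) → ℝ} (hc : Continuous c) :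
    ∃ π : Measure (ι → X), IsProbabilityMeasure π ∧ (∀ i, π.map (fun x => x i) = ρ i) ∧
      ∀ π' : Measure (ι → X), IsProbabilityMeasure π' → (∀ i, π'.map (fun x => x i) = ρ i) →
        ∫⁻ x, ENNReal.ofReal (c x) ∂π ≤ ∫⁻ x, ENNReal.ofReal (c x) ∂π' := by
  have hne : {π : ProbabilityMeasure (ι → X) | ∀ i,
      π.map (measurable_pi_apply i).aemeasurable =
        (⟨ρ i, inferInstance⟩ : ProbabilityMeasure X)}.Nonempty := by
    refine ⟨⟨Measure.pi ρ, inferInstance⟩, fun i => ?_⟩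
    apply Subtype.ext
    exact (measurePreserving_eval ρ i).map_eq
  obtain ⟨π, hπ, hmin⟩ :=
    (lowerSemicontinuous_lintegral_ofReal hc).lowerSemicontinuousOn _ |>.exists_isMinOn hne
      (isCompact_setOf_map_eval_eq _)
  refine ⟨π, inferInstance, fun i => ?_, fun π' h1 h2 => ?_⟩
  · exact congrArg (fun μ : ProbabilityMeasure X => (μ : Measure X)) (hπ i)
  · exact hmin (a := ⟨π', h1⟩) fun i => Subtype.ext (h2 i)

section Paths

variable {d N : ℕ}

lemma continuous_uncurry_pathExt : Continuous (Function.uncurry (pathExt d N)) := by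
  have h : Continuous fun p : PathSpace d N × ℝ =>
      p.1 (projIcc (0:ℝ) (N:ℝ) (Nat.cast_nonneg N) p.2) := by fun_prop
  exact h

lemma continuous_pathExt (ω : PathSpace d N) : Continuous (pathExt d N ω) :=
  continuous_uncurry_pathExt.comp (Continuous.prodMk_right ω)

lemma continuous_pathExt_apply (t : ℝ) : Continuous fun ω => pathExt d N ω t :=
  continuous_uncurry_pathExt.comp (Continuous.prodMk_left t)

lemma pathExt_of_mem (ω : PathSpace d N) {t : ℝ} (ht : t ∈ Icc (0:ℝ) N) :
    pathExt d N ω t = ω ⟨t, ht⟩ := by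
  rw [pathExt, projIcc_of_mem _ ht]

/-- The path on `[0, N]` with second derivative `g`, value `a` at `0` and slope `b` at `0`. -/
def pathOfDeriv₂ (N : ℕ) (a b : EuclideanSpace ℝ (Fin d)) (g : ℝ → EuclideanSpace ℝ (Fin d))
    (hg : Continuous g) : PathSpace d N :=
  ⟨fun t => doublePrimitive a b g t,
    (contDiff_doublePrimitive hg).continuous.comp continuous_subtype_val⟩

variable {a b : EuclideanSpace ℝ (Fin d)} {g : ℝ → EuclideanSpace ℝ (Fin d)}

lemma pathOfDeriv₂_mem_C2paths (hg : Continuous g) : pathOfDeriv₂ N a b g hg ∈ C2paths d N :=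
  ⟨doublePrimitive a b g, contDiff_doublePrimitive hg, fun _ => rfl⟩

lemma pathExt_pathOfDeriv₂ (hg : Continuous g) {t : ℝ} (ht : t ∈ Icc (0:ℝ) N) :
    pathExt d N (pathOfDeriv₂ N a b g hg) t = doublePrimitive a b g t :=
  pathExt_of_mem _ ht

lemma exists_eq_pathOfDeriv₂ {ω : PathSpace d N} (hω : ω ∈ C2paths d N) :
    ∃ a b g, ∃ hg : Continuous g, ω = pathOfDeriv₂ N a b g hg := by
  obtain ⟨f, hf, hωf⟩ := hω
  have hc : Continuous (deriv (deriv f)) := by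
    rw [show (2 : WithTop ℕ∞) = 1 + 1 by norm_num, contDiff_succ_iff_deriv] at hf
    exact hf.2.2.continuous_deriv le_rfl
  refine ⟨f 0, deriv f 0, deriv (deriv f), hc, ContinuousMap.ext fun t => ?_⟩
  rw [hωf t]
  exact congrFun hf.eq_doublePrimitive t

lemma energy_pathOfDeriv₂ (hg : Continuous g) :
    energy d N (pathOfDeriv₂ N a b g hg) = ∫ t in (0:ℝ)..N, ‖g t‖ ^ 2 := by
  rw [energy, intervalIntegral.integral_of_le N.cast_nonneg,
    intervalIntegral.integral_of_le N.cast_nonneg, integral_Ioc_eq_integral_Ioo,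
    integral_Ioc_eq_integral_Ioo]
  refine setIntegral_congr_fun measurableSet_Ioo fun t ht => ?_
  have h : pathExt d N (pathOfDeriv₂ N a b g hg) =ᶠ[𝓝 t] doublePrimitive a b g := by
    filter_upwards [Ioo_mem_nhds ht.1 ht.2] with s hs
    exact pathExt_pathOfDeriv₂ hg (Ioo_subset_Icc_self hs)
  have hd : deriv (doublePrimitive a b g) = fun t => b + ∫ s in (0:ℝ)..t, g s :=
    funext fun t => (hasDerivAt_doublePrimitive hg t).deriv
  simp only [h.deriv.deriv_eq, hd, (hasDerivAt_add_integral hg t).deriv]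

lemma continuous_pathOfDeriv₂ {X : Type*} [TopologicalSpace X] [FirstCountableTopology X]
    {A B : X → EuclideanSpace ℝ (Fin d)} {G : X → ℝ → EuclideanSpace ℝ (Fin d)}
    (hA : Continuous A) (hB : Continuous B) (hG : Continuous (Function.uncurry G))
    (hG' : ∀ x, Continuous (G x)) :
    Continuous fun x => pathOfDeriv₂ N (A x) (B x) (G x) (hG' x) :=
  ContinuousMap.continuous_of_continuous_uncurry _
    ((continuous_uncurry_doublePrimitive hA hB hG).comp
      (continuous_fst.prodMk (continuous_subtype_val.comp continuous_snd)))

/-- By the Lusin–Souslin theorem, the set of `C²` paths is Borel. -/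
lemma measurableSet_C2paths (hN : 1 ≤ N) : MeasurableSet (C2paths d N) := by
  have hN0 : (0:ℝ) < N := by exact_mod_cast hN
  let E := EuclideanSpace ℝ (Fin d)
  let Ψ : E × E × PathSpace d N → PathSpace d N := fun p =>
    pathOfDeriv₂ N p.1 p.2.1 (pathExt d N p.2.2) (continuous_pathExt _)
  have hΨ : Continuous Ψ := by
    refine continuous_pathOfDeriv₂ continuous_fst (continuous_fst.comp continuous_snd) ?_ _
    exact continuous_uncurry_pathExt.comp
      ((continuous_snd.comp (continuous_snd.comp continuous_fst)).prodMk continuous_snd)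
  have hrange : C2paths d N = range Ψ := by
    refine Subset.antisymm (fun ω hω => ?_) ?_
    · obtain ⟨a, b, g, hg, rfl⟩ := exists_eq_pathOfDeriv₂ hω
      refine ⟨(a, b, ⟨fun t => g t, hg.comp continuous_subtype_val⟩), ContinuousMap.ext fun t => ?_⟩
      exact doublePrimitive_congr t.2 fun s hs => pathExt_of_mem _ hs
    · rintro _ ⟨p, rfl⟩
      exact pathOfDeriv₂_mem_C2paths _
  have hinj : Function.Injective Ψ := by
    rintro ⟨a, b, g⟩ ⟨a', b', g'⟩ h
    have hu := uniqueDiffOn_Icc hN0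
    have h0 : (0:ℝ) ∈ Icc (0:ℝ) N := ⟨le_rfl, hN0.le⟩
    have e0 : EqOn (doublePrimitive a b (pathExt d N g))
        (doublePrimitive a' b' (pathExt d N g')) (Icc 0 N) := fun t ht =>
      congrArg (fun ω : PathSpace d N => ω ⟨t, ht⟩) h
    have e1 : EqOn (fun t => b + ∫ s in (0:ℝ)..t, pathExt d N g s)
        (fun t => b' + ∫ s in (0:ℝ)..t, pathExt d N g' s) (Icc 0 N) := fun t ht =>
      (hu t ht).eq_deriv _
        (hasDerivAt_doublePrimitive (continuous_pathExt g) t).hasDerivWithinAt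
        ((hasDerivAt_doublePrimitive (continuous_pathExt g') t).hasDerivWithinAt.congr e0 (e0 ht))
    have e2 : EqOn (pathExt d N g) (pathExt d N g') (Icc 0 N) := fun t ht =>
      (hu t ht).eq_deriv _
        (hasDerivAt_add_integral (continuous_pathExt g) t).hasDerivWithinAt
        ((hasDerivAt_add_integral (continuous_pathExt g') t).hasDerivWithinAt.congr e1 (e1 ht))
    have ha : a = a' := by simpa [doublePrimitive_zero] using e0 h0
    have hb : b = b' := by simpa using e1 h0
    have hg : g = g' := ContinuousMap.ext fun t => by
      simpa [pathExt_of_mem _ t.2] using e2 t.2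
    rw [ha, hb, hg]
  rw [hrange]
  exact measurableSet_range_of_continuous_injective hΨ hinj

/-- The second differences of a finite sequence. -/
def secondDiff {E : Type*} [AddCommGroup E] [Module ℝ E] (x : Fin (N + 1) → E) :
    Fin (N - 1) → E :=
  fun i => x ⟨i + 2, by omega⟩ - (2:ℝ) • x ⟨i + 1, by omega⟩ + x ⟨i, by omega⟩

lemma integral_hat_smul_eq_secondDiff (hg : Continuous g) (i : Fin (N - 1)) :
    ∫ s in (0:ℝ)..N, hat i s • g s =
      secondDiff (fun k : Fin (N + 1) => doublePrimitive a b g ((k : ℕ) : ℝ)) i := by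
  rw [integral_hat_smul (a := a) (b := b) hg (by omega)]
  simp [secondDiff]

/-- A sequence is determined by its first two values and its second differences. -/
lemma eq_of_secondDiff_eq {E : Type*} [AddCommGroup E] [Module ℝ E] {x y : Fin (N + 1) → E}
    (hN : 1 ≤ N) (h0 : x 0 = y 0) (h1 : x ⟨1, by omega⟩ = y ⟨1, by omega⟩)
    (h : secondDiff x = secondDiff y) : x = y := by
  have key : ∀ k (hk : k < N + 1), x ⟨k, hk⟩ = y ⟨k, hk⟩ := by
    intro k
    induction k using Nat.twoStepInduction with
    | zero => exact fun _ => h0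
    | one => exact fun _ => h1
    | more k ih0 ih1 =>
      intro hk
      have := congrFun h ⟨k, by omega⟩
      simp only [secondDiff] at this
      rw [ih0 (by omega), ih1 (by omega)] at this
      simpa using this
  exact funext fun k => key k k.2

/-- Second differences can be matched, continuously, by integrals of piecewise linear curves
against hat functions. -/
lemma exists_hatCurve_integral_eq_secondDiff (d N : ℕ) :
    ∃ y : (Fin (N + 1) → EuclideanSpace ℝ (Fin d)) → Fin (N - 1) → EuclideanSpace ℝ (Fin d),
      Continuous y ∧ ∀ x (i : Fin (N - 1)),
        ∫ t in (0:ℝ)..N, hat i t • hatCurve (y x) t = secondDiff x i := by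
  let T := LinearEquiv.ofInjectiveEndo (hatGram (EuclideanSpace ℝ (Fin d)) (N - 1) N)
      (hatGram_injective (by exact_mod_cast Nat.sub_le N 1))
  refine ⟨fun x => T.symm (secondDiff x), ?_,
    fun x i => congrFun (T.apply_symm_apply (secondDiff x)) i⟩
  have hT : Continuous T.symm := T.symm.toLinearMap.continuous_of_finiteDimensional
  refine hT.comp ?_
  unfold secondDiff
  fun_prop

/-- Natural cubic splines: there is a continuous choice of an energy-minimizing `C²` path through
prescribed points at integer times, and its energy depends continuously on these points. -/
lemma exists_minimal_interpolation (d : ℕ) (hN : 1 ≤ N) :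
    ∃ S : (Fin (N + 1) → EuclideanSpace ℝ (Fin d)) → PathSpace d N, Continuous S ∧
      (∀ x, S x ∈ C2paths d N) ∧
      (∀ x (i : Fin (N + 1)), pathExt d N (S x) ((i : ℕ) : ℝ) = x i) ∧
      Continuous (fun x => energy d N (S x)) ∧
      ∀ ω ∈ C2paths d N,
        energy d N (S fun i => pathExt d N ω ((i : ℕ) : ℝ)) ≤ energy d N ω := by
  have hmem : ∀ i : Fin (N + 1), ((i : ℕ) : ℝ) ∈ Icc (0:ℝ) N := fun i =>
    ⟨Nat.cast_nonneg _, by exact_mod_cast Nat.lt_succ_iff.1 i.2⟩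
  have hN0 : (0:ℝ) ≤ N := N.cast_nonneg
  obtain ⟨y, hy, hGram⟩ := exists_hatCurve_integral_eq_secondDiff d N
  have hG : Continuous (Function.uncurry fun x => hatCurve (y x)) :=
    continuous_uncurry_hatCurve.comp ((hy.comp continuous_fst).prodMk continuous_snd)
  have hG' : ∀ x, Continuous (hatCurve (y x)) := fun x => continuous_hatCurve _
  let B : (Fin (N + 1) → EuclideanSpace ℝ (Fin d)) → EuclideanSpace ℝ (Fin d) := fun x =>
    x ⟨1, by omega⟩ - x 0 - doublePrimitive 0 0 (hatCurve (y x)) 1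
  have hB : Continuous B := by
    have h1 := continuous_uncurry_doublePrimitive (A := fun _ => 0) (B := fun _ => 0)
      continuous_const continuous_const hG
    have h2 := h1.comp (Continuous.prodMk_left (1:ℝ))
    simp only [Function.comp_def] at h2
    fun_prop
  have hinterp : ∀ x (i : Fin (N + 1)),
      doublePrimitive (x 0) (B x) (hatCurve (y x)) ((i : ℕ) : ℝ) = x i := by
    intro x
    refine congrFun (eq_of_secondDiff_eq
      (x := fun i : Fin (N + 1) => doublePrimitive (x 0) (B x) (hatCurve (y x)) ((i : ℕ) : ℝ))
      hN ?_ ?_ ?_)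
    · simp [doublePrimitive_zero]
    · simp [doublePrimitive, B]
      abel
    · funext i
      rw [← integral_hat_smul_eq_secondDiff (hG' x), hGram]
  clear_value B
  refine ⟨fun x => pathOfDeriv₂ N (x 0) (B x) (hatCurve (y x)) (hG' x),
    continuous_pathOfDeriv₂ (continuous_apply 0) hB hG hG',
    fun x => pathOfDeriv₂_mem_C2paths _, fun x i => ?_, ?_, ?_⟩
  · rw [pathExt_pathOfDeriv₂ _ (hmem i), hinterp]
  · simp_rw [energy_pathOfDeriv₂]
    exact intervalIntegral.continuous_parametric_intervalIntegral_of_continuous'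
      (hG.norm.pow 2) _ _
  · intro ω hω
    obtain ⟨a, b, h, hh, rfl⟩ := exists_eq_pathOfDeriv₂ hω
    simp_rw [energy_pathOfDeriv₂]
    set x : Fin (N + 1) → EuclideanSpace ℝ (Fin d) :=
      fun i => pathExt d N (pathOfDeriv₂ N a b h hh) ((i : ℕ) : ℝ)
    have hxe : x = fun i : Fin (N + 1) => doublePrimitive a b h ((i : ℕ) : ℝ) :=
      funext fun i => pathExt_pathOfDeriv₂ hh (hmem i)
    refine integral_norm_sq_hatCurve_le hN0 hh fun i => ?_
    rw [hGram, hxe, integral_hat_smul_eq_secondDiff hh]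

end Paths

/-- For probability measures `ρ₀,…,ρ_N` on `ℝ^d` with finite second moments, the
infimum of the mean-squared acceleration over all admissible measures on path space
(probability measures concentrated on C² paths with time-`i` marginals `ρ i`)
is attained. -/
theorem stmt8 (d N : ℕ) (hd : 1 ≤ d) (hN : 1 ≤ N)
    (ρ : Fin (N + 1) → Measure (EuclideanSpace ℝ (Fin d)))
    (hprob : ∀ i, IsProbabilityMeasure (ρ i))
    (hmom : ∀ i, (∫⁻ z, ENNReal.ofReal (‖z‖ ^ 2) ∂(ρ i)) < ⊤) :
    ∃ P : Measure (PathSpace d N),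
      IsProbabilityMeasure P ∧ P (C2paths d N) = 1 ∧
      (∀ i : Fin (N + 1), P.map (fun ω => pathExt d N ω ((i : ℕ) : ℝ)) = ρ i) ∧
      ∀ P' : Measure (PathSpace d N), IsProbabilityMeasure P' →
        P' (C2paths d N) = 1 →
        (∀ i : Fin (N + 1), P'.map (fun ω => pathExt d N ω ((i : ℕ) : ℝ)) = ρ i) →
        (∫⁻ ω, ENNReal.ofReal (energy d N ω) ∂P) ≤
          ∫⁻ ω, ENNReal.ofReal (energy d N ω) ∂P' := by
  obtain ⟨S, hS, hSC2, hSi, hSe, hSmin⟩ := exists_minimal_interpolation d hN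
  obtain ⟨π, hπ, hπi, hπmin⟩ := exists_optimal_coupling ρ hSe
  have hC2 : MeasurableSet (C2paths d N) := measurableSet_C2paths hN
  refine ⟨π.map S, Measure.isProbabilityMeasure_map hS.aemeasurable, ?_, fun i => ?_, ?_⟩
  · rw [Measure.map_apply hS.measurable hC2, preimage_eq_univ_iff.2 (range_subset_iff.2 hSC2),
      measure_univ]
  · rw [Measure.map_map (continuous_pathExt_apply _).measurable hS.measurable, ← hπi i]
    congr 1
    exact funext fun x => hSi x i
  · intro P' hP' hP'C2 hP'i
    have hev : Measurable fun (ω : PathSpace d N) (i : Fin (N + 1)) =>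
        pathExt d N ω ((i : ℕ) : ℝ) :=
      measurable_pi_lambda _ fun i => (continuous_pathExt_apply _).measurable
    calc ∫⁻ ω, ENNReal.ofReal (energy d N ω) ∂(π.map S)
        ≤ ∫⁻ x, ENNReal.ofReal (energy d N (S x)) ∂π := lintegral_map_le _ _
      _ ≤ ∫⁻ x, ENNReal.ofReal (energy d N (S x))
            ∂(P'.map fun ω (i : Fin (N + 1)) => pathExt d N ω ((i : ℕ) : ℝ)) := by
          refine hπmin _ (Measure.isProbabilityMeasure_map hev.aemeasurable) fun i => ?_
          rw [Measure.map_map (measurable_pi_apply i) hev, ← hP'i i]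
          rfl
      _ = ∫⁻ ω, ENNReal.ofReal (energy d N (S fun i : Fin (N + 1) => pathExt d N ω ((i : ℕ) : ℝ))) ∂P' :=
          lintegral_map (ENNReal.measurable_ofReal.comp hSe.measurable) hev
      _ ≤ ∫⁻ ω, ENNReal.ofReal (energy d N ω) ∂P' := by
          have hae : ∀ᵐ ω ∂P', ω ∈ C2paths d N :=
            (prob_compl_eq_zero_iff hC2).2 hP'C2
          refine lintegral_mono_ae ?_
          filter_upwards [hae] with ω hω
          exact ENNReal.ofReal_le_ofReal (hSmin ω hω)
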